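/- arXiv:1703.05729 — 7 statements merged into one kernel-verified Lean document; each statement's English description precedes it below -/
import Mathlib

section
/- Let p be a prime and let n₁, n₂ be positive integers; set q₁ = p^{n₁} and q₂ = p^{n₂}. Then the abelian groups ∏_{n≥1} ∏_{j∈ℕ} ℤ/(q₁^n − 1)ℤ and ∏_{n≥1} ∏_{j∈ℕ} ℤ/(q₂^n − 1)ℤ (products over all integers n ≥ 1 and countably many copies j for each n) are isomorphic as groups if and only if d_{q₁} = d_{q₂}, i.e. if and only if n₁/p^{ord_p(n₁)} = n₂/p^{ord_p(n₂)}. -/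
/-- The condition that the Ulm invariant of index `k` of `G` at `ℓ` is nonzero. -/
def HasUlm (G : Type*) [AddCommGroup G] (ℓ k : ℕ) : Prop :=
  ∃ y : G, ℓ ^ (k + 1) • y = 0 ∧ ∀ z : G, ℓ ^ (k + 1) • z ≠ ℓ ^ k • y

theorem HasUlm.of_addEquiv {G H : Type*} [AddCommGroup G] [AddCommGroup H] (e : G ≃+ H)
    {ℓ k : ℕ} (h : HasUlm G ℓ k) : HasUlm H ℓ k := by
  obtain ⟨y, hy, hz⟩ := h
  refine ⟨e y, by rw [← map_nsmul, hy, map_zero], fun z h ↦ hz (e.symm z) (e.injective ?_)⟩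
  simpa using h

theorem hasUlm_pi_iff {ι : Type*} {A : ι → Type*} [∀ i, AddCommGroup (A i)] {ℓ k : ℕ} :
    HasUlm (∀ i, A i) ℓ k ↔ ∃ i, HasUlm (A i) ℓ k := by
  classical
  constructor
  · rintro ⟨y, hy, hz⟩
    by_contra! h
    have h' (i : ι) : ∃ z : A i, ℓ ^ (k + 1) • z = ℓ ^ k • y i := by
      by_contra! h'
      exact h i ⟨y i, congrFun hy i, h'⟩
    choose z hz' using h'
    exact hz z (funext hz')
  · rintro ⟨i, y, hy, hz⟩
    refine ⟨Pi.single i y, by rw [← Pi.single_smul, hy, Pi.single_zero], fun z h ↦ hz (z i) ?_⟩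
    simpa using congrFun h i

theorem hasUlm_zmod_iff {m ℓ k : ℕ} (hm : m ≠ 0) (hℓ : ℓ.Prime) :
    HasUlm (ZMod m) ℓ k ↔ m.factorization ℓ = k + 1 := by
  have : NeZero m := ⟨hm⟩
  constructor
  · rintro ⟨y, hy, hz⟩
    rcases lt_trichotomy (m.factorization ℓ) (k + 1) with h | h | h
    · exfalso
      have hcop : IsCoprime (ℓ : ℤ) ((m / ℓ ^ m.factorization ℓ : ℕ) : ℤ) :=
        Nat.isCoprime_iff_coprime.2 (Nat.coprime_ordCompl hℓ hm)
      obtain ⟨a, b, hab⟩ := hcop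
      have hdvd : m ∣ (m / ℓ ^ m.factorization ℓ) * ℓ ^ k := by
        conv_lhs => rw [← Nat.ordProj_mul_ordCompl_eq_self m ℓ, mul_comm]
        exact mul_dvd_mul_left _ (pow_dvd_pow _ (by omega))
      generalize m / ℓ ^ m.factorization ℓ = u at hab hdvd
      have hzero := (ZMod.natCast_eq_zero_iff _ m).2 hdvd
      have hab' := congrArg (Int.cast : ℤ → ZMod m) hab
      push_cast at hab' hzero
      apply hz (a * y)
      simp only [nsmul_eq_mul]
      push_cast
      linear_combination (ℓ : ZMod m) ^ k * y * hab' - b * y * hzero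
    · exact h
    · exfalso
      obtain ⟨c, rfl⟩ : ∃ c : ℕ, (c : ZMod m) = y := ⟨y.val, by simp⟩
      rw [nsmul_eq_mul, ← Nat.cast_mul, ZMod.natCast_eq_zero_iff] at hy
      have h1 : ℓ ^ (k + 1) * ℓ ∣ ℓ ^ (k + 1) * c := by
        rw [← pow_succ]
        exact ((pow_dvd_pow _ h).trans (Nat.ordProj_dvd m ℓ)).trans hy
      obtain ⟨d, rfl⟩ := Nat.dvd_of_mul_dvd_mul_left (pow_pos hℓ.pos _) h1
      apply hz (d : ZMod m)
      simp only [nsmul_eq_mul]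
      push_cast
      ring
  · intro h
    obtain ⟨u, hu⟩ : ℓ ^ (k + 1) ∣ m := h ▸ Nat.ordProj_dvd m ℓ
    refine ⟨(u : ZMod m), ?_, fun z hz ↦ ?_⟩
    · rw [nsmul_eq_mul, ← Nat.cast_mul, ZMod.natCast_eq_zero_iff, hu]
    · obtain ⟨c, rfl⟩ : ∃ c : ℕ, (c : ZMod m) = z := ⟨z.val, by simp⟩
      simp only [nsmul_eq_mul, ← Nat.cast_mul] at hz
      rw [ZMod.natCast_eq_natCast_iff] at hz
      have h2 : ℓ ^ (k + 1) ∣ ℓ ^ k * u :=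
        ((hz.of_dvd ⟨u, hu⟩).dvd_iff dvd_rfl).1 (dvd_mul_right _ _)
      rw [pow_succ] at h2
      have h3 : ℓ ∣ u := Nat.dvd_of_mul_dvd_mul_left (pow_pos hℓ.pos _) h2
      refine Nat.pow_succ_factorization_not_dvd hm hℓ ?_
      rw [h, hu, pow_succ _ (k + 1)]
      exact mul_dvd_mul_left _ h3

theorem exists_equiv_of_infinite_fibers {I J α : Type*} [Countable I] [Countable J]
    (f : I → α) (g : J → α) (hf : ∀ i, Infinite {x // f x = f i})
    (hg : ∀ j, Infinite {x // g x = g j}) (hfg : Set.range f = Set.range g) :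
    ∃ e : I ≃ J, ∀ i, g (e i) = f i := by
  have h (a : α) : Nonempty ({x // f x = a} ≃ {x // g x = a}) := by
    by_cases ha : a ∈ Set.range f
    · obtain ⟨j, hj⟩ := hfg ▸ ha
      obtain ⟨i, rfl⟩ := ha
      have := hf i
      have : Infinite {x // g x = f i} := hj ▸ hg j
      exact nonempty_equiv_of_countable
    · have : IsEmpty {x // f x = a} := ⟨fun x ↦ ha ⟨x, x.2⟩⟩
      have : IsEmpty {x // g x = a} := ⟨fun x ↦ ha (hfg ▸ ⟨x, x.2⟩)⟩
      exact ⟨Equiv.equivOfIsEmpty _ _⟩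
  refine ⟨(Equiv.sigmaFiberEquiv f).symm.trans
    ((Equiv.sigmaCongrRight fun a ↦ (h a).some).trans (Equiv.sigmaFiberEquiv g)), fun i ↦ ?_⟩
  exact ((h (f i)).some ⟨i, rfl⟩).2

/-- Chinese remainder theorem for a countable power of a product of finite cyclic groups. -/
noncomputable def piZModEquiv {ι : Type*} (m : ι → ℕ) (hm : ∀ i, m i ≠ 0) :
    ((i : ι) → ℕ → ZMod (m i)) ≃+
      ((x : Σ i, ℕ × (m i).primeFactors) → ZMod ((x.2.2 : ℕ) ^ (m x.1).factorization x.2.2)) where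
  toFun a x := ZMod.equivPi _ (hm x.1) (a x.1 x.2.1) x.2.2
  invFun b i j := (ZMod.equivPi _ (hm i)).symm fun l ↦ b ⟨i, j, l⟩
  left_inv a := by
    funext i j
    exact (ZMod.equivPi _ (hm i)).symm_apply_apply (a i j)
  right_inv b := by
    funext ⟨i, j, l⟩
    exact congrFun ((ZMod.equivPi _ (hm i)).apply_symm_apply fun l ↦ b ⟨i, j, l⟩) l
  map_add' a b := by
    funext x
    simp

theorem infinite_fiber_prime_pow {ι : Type*} (m : ι → ℕ) (x : Σ i, ℕ × (m i).primeFactors) :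
    Infinite {y : Σ i, ℕ × (m i).primeFactors //
      (y.2.2 : ℕ) ^ (m y.1).factorization y.2.2 = (x.2.2 : ℕ) ^ (m x.1).factorization x.2.2} := by
  refine Infinite.of_injective (fun j : ℕ ↦ ⟨⟨x.1, j, x.2.2⟩, rfl⟩) fun j j' hj ↦ ?_
  simpa using hj

theorem range_prime_pow_subset {ι κ : Type*} (m : ι → ℕ) (m' : κ → ℕ)
    (h : ∀ i, ∀ ℓ ∈ (m i).primeFactors, ∃ j, (m' j).factorization ℓ = (m i).factorization ℓ) :
    Set.range (fun x : Σ i, ℕ × (m i).primeFactors ↦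
      (x.2.2 : ℕ) ^ (m x.1).factorization x.2.2) ⊆
    Set.range (fun x : Σ i, ℕ × (m' i).primeFactors ↦
      (x.2.2 : ℕ) ^ (m' x.1).factorization x.2.2) := by
  rintro _ ⟨⟨i, n, ℓ, hℓ⟩, rfl⟩
  obtain ⟨j, hj⟩ := h i ℓ hℓ
  have hℓ' : ℓ ∈ (m' j).primeFactors := by
    rw [← Nat.support_factorization, Finsupp.mem_support_iff] at hℓ ⊢
    rwa [hj]
  exact ⟨⟨j, n, ℓ, hℓ'⟩, by simp only [hj]⟩

theorem nonempty_addEquiv_of_factorization {ι κ : Type*} [Countable ι] [Countable κ]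
    (m : ι → ℕ) (m' : κ → ℕ) (hm : ∀ i, m i ≠ 0) (hm' : ∀ i, m' i ≠ 0)
    (h : ∀ i, ∀ ℓ ∈ (m i).primeFactors, ∃ j, (m' j).factorization ℓ = (m i).factorization ℓ)
    (h' : ∀ j, ∀ ℓ ∈ (m' j).primeFactors, ∃ i, (m i).factorization ℓ = (m' j).factorization ℓ) :
    Nonempty (((i : ι) → ℕ → ZMod (m i)) ≃+ ((i : κ) → ℕ → ZMod (m' i))) := by
  obtain ⟨e, he⟩ := exists_equiv_of_infinite_fibers _ _ (infinite_fiber_prime_pow m)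
    (infinite_fiber_prime_pow m')
    ((range_prime_pow_subset m m' h).antisymm (range_prime_pow_subset m' m h'))
  exact ⟨(piZModEquiv m hm).trans
    (((RingEquiv.piCongrRight fun x ↦ ZMod.ringEquivCongr (he x).symm).trans
      (RingEquiv.piCongrLeft (fun y : Σ i, ℕ × (m' i).primeFactors ↦
        ZMod ((y.2.2 : ℕ) ^ (m' y.1).factorization y.2.2)) e)).toAddEquiv.trans
      (piZModEquiv m' hm').symm)⟩

theorem Nat.factorization_pow_sub_one {x ℓ c : ℕ} (hx : 0 < x) (hℓ : ℓ.Prime) (hdvd : ℓ ∣ x - 1)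
    (hc : ¬ ℓ ∣ c) : (x ^ c - 1).factorization ℓ = (x - 1).factorization ℓ := by
  rcases Nat.eq_or_lt_of_le (Nat.succ_le_of_lt hx) with rfl | hx1
  · simp
  have hc0 : c ≠ 0 := by rintro rfl; simp at hc
  have hxc : 1 < x ^ c := Nat.one_lt_pow hc0 hx1
  have hcast (y : ℕ) (hy : 1 < y) :
      emultiplicity (ℓ : ℤ) ((y : ℤ) - 1) = (y - 1).factorization ℓ := by
    rw [← Nat.cast_pred (by omega), Int.natCast_emultiplicity, Nat.factorization_def _ hℓ,
      ← @padicValNat_eq_emultiplicity _ ⟨hℓ⟩ _ (by omega)]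
  have hd : (ℓ : ℤ) ∣ (x : ℤ) - 1 := by
    rw [← Nat.cast_pred hx]
    exact Int.natCast_dvd_natCast.2 hdvd
  have key := emultiplicity_pow_sub_pow_of_prime (Nat.prime_iff_prime_int.1 hℓ) hd
    (fun h ↦ hℓ.one_lt.ne' (by
      have : (ℓ : ℤ) ∣ 1 := (dvd_sub_right h).1 hd
      exact Nat.dvd_one.1 (by exact_mod_cast this))) (n := c) (by exact_mod_cast hc)
  rw [one_pow, hcast x hx1, ← Nat.cast_pow, hcast _ hxc] at key
  exact_mod_cast key

theorem Nat.factorization_sub_one_lt_factorization_pow_prime_sub_one {x ℓ : ℕ} (hx : 1 < x)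
    (hℓ : ℓ.Prime) (hdvd : ℓ ∣ x - 1) :
    (x - 1).factorization ℓ < (x ^ ℓ - 1).factorization ℓ := by
  have hxℓ : 1 < x ^ ℓ := Nat.one_lt_pow hℓ.ne_zero hx
  rw [← Nat.succ_le_iff, ← hℓ.pow_dvd_iff_le_factorization (by omega),
    ← Int.natCast_dvd_natCast, Nat.cast_sub hxℓ.le]
  have hd : (ℓ : ℤ) ∣ (x : ℤ) - 1 := by
    rw [← Nat.cast_pred (by omega)]
    exact Int.natCast_dvd_natCast.2 hdvd
  have hpow : (ℓ : ℤ) ^ (x - 1).factorization ℓ ∣ (x : ℤ) - 1 := by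
    rw [← Nat.cast_pred (by omega)]
    exact_mod_cast Nat.ordProj_dvd (x - 1) ℓ
  have hsum := dvd_geom_sum₂_self hd
  have := geom_sum₂_mul (x : ℤ) 1 ℓ
  push_cast
  rw [one_pow] at this
  rw [← this, pow_succ, mul_comm]
  exact mul_dvd_mul hsum hpow

theorem Nat.dvd_sub_one_of_dvd_pow_prime_sub_one {x ℓ : ℕ} (hx : 0 < x) (hℓ : ℓ.Prime)
    (h : ℓ ∣ x ^ ℓ - 1) : ℓ ∣ x - 1 := by
  have := Fact.mk hℓ
  rw [← ZMod.natCast_eq_zero_iff, Nat.cast_sub (Nat.one_le_pow _ _ hx)] at h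
  rw [← ZMod.natCast_eq_zero_iff, Nat.cast_sub hx]
  simpa [ZMod.pow_card] using h

/-- If `b` is more divisible by `ℓ` than `a`, then every positive `ℓ`-adic valuation of a number
`(p ^ b) ^ n - 1` exceeds some positive `ℓ`-adic valuation of a number `(p ^ a) ^ n' - 1`. -/
theorem exists_factorization_lt {p a b ℓ n : ℕ} (hp : p.Prime) (hℓ : ℓ.Prime) (ha : 0 < a)
    (hb : 0 < b) (hn : 0 < n) (hab : a.factorization ℓ < b.factorization ℓ)
    (h : 0 < ((p ^ b) ^ n - 1).factorization ℓ) :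
    ∃ n' : ℕ, 0 < n' ∧ 0 < ((p ^ a) ^ n' - 1).factorization ℓ ∧
      ((p ^ a) ^ n' - 1).factorization ℓ < ((p ^ b) ^ n - 1).factorization ℓ := by
  obtain ⟨w, hw, hwa⟩ : ∃ w, ¬ ℓ ∣ w ∧ a = ℓ ^ a.factorization ℓ * w :=
    ⟨_, Nat.not_dvd_ordCompl hℓ ha.ne', (Nat.ordProj_mul_ordCompl_eq_self a ℓ).symm⟩
  obtain ⟨u, hu⟩ : ℓ ^ (a.factorization ℓ + 1) ∣ b :=
    (pow_dvd_pow _ hab).trans (Nat.ordProj_dvd b ℓ)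
  generalize a.factorization ℓ = s at hwa hu
  have hu0 : 0 < u := Nat.pos_of_ne_zero (by rintro rfl; simp at hu; omega)
  set x := p ^ (ℓ ^ s * u * n) with hx
  have hx1 : 1 < x :=
    Nat.one_lt_pow (mul_pos (mul_pos (pow_pos hℓ.pos _) hu0) hn).ne' hp.one_lt
  have hbx : (p ^ b) ^ n = x ^ ℓ := by
    rw [hx, hu, ← pow_mul, ← pow_mul]
    congr 1
    ring
  have hax : (p ^ a) ^ (u * n) = x ^ w := by
    rw [hx, hwa, ← pow_mul, ← pow_mul]
    congr 1
    ring
  rw [hbx] at h ⊢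
  have hd : ℓ ∣ x - 1 :=
    Nat.dvd_sub_one_of_dvd_pow_prime_sub_one hx1.le hℓ (Nat.dvd_of_factorization_pos h.ne')
  refine ⟨u * n, mul_pos hu0 hn, ?_, ?_⟩
  · rw [hax, Nat.factorization_pow_sub_one hx1.le hℓ hd hw]
    exact hℓ.factorization_pos_of_dvd (by omega) hd
  · rw [hax, Nat.factorization_pow_sub_one hx1.le hℓ hd hw]
    exact Nat.factorization_sub_one_lt_factorization_pow_prime_sub_one hx1 hℓ hd

theorem factorization_le_of_valuations_subset {p a b ℓ : ℕ} (hp : p.Prime) (hℓ : ℓ.Prime)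
    (hne : ℓ ≠ p) (ha : 0 < a) (hb : 0 < b)
    (h : ∀ n, 0 < n → 0 < ((p ^ a) ^ n - 1).factorization ℓ →
      ∃ n', 0 < n' ∧ ((p ^ b) ^ n' - 1).factorization ℓ = ((p ^ a) ^ n - 1).factorization ℓ) :
    b.factorization ℓ ≤ a.factorization ℓ := by
  by_contra! hab
  have descent (k : ℕ) : ∀ n, 0 < n → 0 < ((p ^ b) ^ n - 1).factorization ℓ →
      ((p ^ b) ^ n - 1).factorization ℓ ≠ k := by
    induction k using Nat.strong_induction_on with
    | _ k ih =>
      rintro n hn hpos rfl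
      obtain ⟨n', hn', hpos', hlt⟩ := exists_factorization_lt hp hℓ ha hb hn hab hpos
      obtain ⟨n'', hn'', heq⟩ := h n' hn' hpos'
      exact ih _ hlt n'' hn'' (heq ▸ hpos') heq
  have hℓ1 : 0 < ℓ - 1 := Nat.sub_pos_of_lt hℓ.one_lt
  refine descent _ (ℓ - 1) hℓ1 (hℓ.factorization_pos_of_dvd ?_ ?_) rfl
  · exact (Nat.sub_pos_of_lt
      (Nat.one_lt_pow hℓ1.ne' (Nat.one_lt_pow hb.ne' hp.one_lt))).ne'
  · have := Fact.mk hℓ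
    rw [← ZMod.natCast_eq_zero_iff, Nat.cast_sub (Nat.one_le_pow _ _ (pow_pos hp.pos _))]
    have hp0 : ((p ^ b : ℕ) : ZMod ℓ) ≠ 0 := by
      rw [Ne, ZMod.natCast_eq_zero_iff]
      exact fun h ↦ hne ((Nat.prime_dvd_prime_iff_eq hℓ hp).1 (hℓ.dvd_of_dvd_pow h))
    rw [Nat.cast_pow, ZMod.pow_card_sub_one_eq_one hp0, Nat.cast_one, sub_self]

theorem hasUlm_pi_zmod_iff {q ℓ k : ℕ} (hq : 1 < q) (hℓ : ℓ.Prime) :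
    HasUlm ((n : {n : ℕ // 1 ≤ n}) → (ℕ → ZMod (q ^ (n : ℕ) - 1))) ℓ k ↔
      ∃ n, 0 < n ∧ (q ^ n - 1).factorization ℓ = k + 1 := by
  have hm (n : {n : ℕ // 1 ≤ n}) : q ^ (n : ℕ) - 1 ≠ 0 :=
    (Nat.sub_pos_of_lt (Nat.one_lt_pow (Nat.pos_iff_ne_zero.1 n.2) hq)).ne'
  simp_rw [hasUlm_pi_iff, hasUlm_zmod_iff (hm _) hℓ]
  simp [Nat.succ_le_iff]

theorem factorization_le_of_addEquiv {p a b ℓ : ℕ} (hp : p.Prime) (hℓ : ℓ.Prime)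
    (hne : ℓ ≠ p) (ha : 0 < a) (hb : 0 < b)
    (e : ((n : {n : ℕ // 1 ≤ n}) → (ℕ → ZMod ((p ^ a) ^ (n : ℕ) - 1))) ≃+
       ((n : {n : ℕ // 1 ≤ n}) → (ℕ → ZMod ((p ^ b) ^ (n : ℕ) - 1)))) :
    b.factorization ℓ ≤ a.factorization ℓ := by
  refine factorization_le_of_valuations_subset hp hℓ hne ha hb fun n hn hpos ↦ ?_
  obtain ⟨k, hk⟩ := Nat.exists_eq_add_of_le' hpos
  rw [hk]
  exact (hasUlm_pi_zmod_iff (Nat.one_lt_pow hb.ne' hp.one_lt) hℓ).1 <| .of_addEquiv e <|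
    (hasUlm_pi_zmod_iff (Nat.one_lt_pow ha.ne' hp.one_lt) hℓ).2 ⟨n, hn, hk⟩

theorem exists_factorization_eq_of_ordCompl_eq {p a b ℓ n : ℕ} (hp : p.Prime) (ha : 0 < a)
    (hn : 1 ≤ n) (hab : a / p ^ a.factorization p = b / p ^ b.factorization p)
    (hmem : ℓ ∈ ((p ^ a) ^ n - 1).primeFactors) :
    ∃ j : {n : ℕ // 1 ≤ n},
      ((p ^ b) ^ (j : ℕ) - 1).factorization ℓ = ((p ^ a) ^ n - 1).factorization ℓ := by
  have hℓ := Nat.prime_of_mem_primeFactors hmem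
  have hd := Nat.dvd_of_mem_primeFactors hmem
  have hpos : 0 < (p ^ a) ^ n := pow_pos (pow_pos hp.pos _) _
  have hne : ¬ ℓ ∣ p ^ b.factorization p := by
    intro h
    have h1 : ℓ ∣ p := hℓ.dvd_of_dvd_pow h
    have h2 : ℓ ∣ (p ^ a) ^ n := dvd_pow (dvd_pow h1 ha.ne') (by omega)
    have h3 := (Nat.dvd_sub_iff_right hpos h2).1 hd
    exact hℓ.one_lt.ne' (Nat.dvd_one.1 h3)
  refine ⟨⟨n * p ^ a.factorization p, Nat.mul_pos hn (pow_pos hp.pos _)⟩, ?_⟩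
  rw [← Nat.factorization_pow_sub_one hpos hℓ hd hne]
  congr 2
  simp only [← pow_mul]
  congr 1
  have h1 := Nat.ordProj_mul_ordCompl_eq_self a p
  have h2 := Nat.ordProj_mul_ordCompl_eq_self b p
  rw [hab] at h1
  generalize a.factorization p = s at *
  generalize b.factorization p = t at *
  generalize b / p ^ t = d at *
  rw [← h1, ← h2]
  ring


/-- Let `p` be a prime, `n₁, n₂` positive, `q₁ = p^n₁`, `q₂ = p^n₂`. Then the abelian
groups `∏_{n ≥ 1} ∏_{j ∈ ℕ} ℤ/(q₁^n - 1)ℤ` and `∏_{n ≥ 1} ∏_{j ∈ ℕ} ℤ/(q₂^n - 1)ℤ`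
are isomorphic if and only if `n₁ / p^(ord_p n₁) = n₂ / p^(ord_p n₂)`. -/
theorem stmt10 (p n₁ n₂ : ℕ) (hp : p.Prime) (h1 : 0 < n₁) (h2 : 0 < n₂) :
    Nonempty
      (((n : {n : ℕ // 1 ≤ n}) → (ℕ → ZMod ((p ^ n₁) ^ (n : ℕ) - 1))) ≃+
       ((n : {n : ℕ // 1 ≤ n}) → (ℕ → ZMod ((p ^ n₂) ^ (n : ℕ) - 1)))) ↔
    n₁ / p ^ padicValNat p n₁ = n₂ / p ^ padicValNat p n₂ := by
  rw [← Nat.factorization_def _ hp, ← Nat.factorization_def _ hp]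
  have hm {a : ℕ} (ha : 0 < a) (n : {n : ℕ // 1 ≤ n}) : (p ^ a) ^ (n : ℕ) - 1 ≠ 0 :=
    (Nat.sub_pos_of_lt (Nat.one_lt_pow (Nat.pos_iff_ne_zero.1 n.2)
      (Nat.one_lt_pow ha.ne' hp.one_lt))).ne'
  constructor
  · rintro ⟨e⟩
    refine Nat.eq_of_factorization_eq (Nat.ordCompl_pos p h1.ne').ne'
      (Nat.ordCompl_pos p h2.ne').ne' fun ℓ ↦ ?_
    rw [Nat.factorization_ordCompl, Nat.factorization_ordCompl]
    by_cases hℓp : ℓ = p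
    · simp [hℓp]
    rw [Finsupp.erase_ne hℓp, Finsupp.erase_ne hℓp]
    by_cases hℓ : ℓ.Prime
    · exact (factorization_le_of_addEquiv hp hℓ hℓp h2 h1 e.symm).antisymm
        (factorization_le_of_addEquiv hp hℓ hℓp h1 h2 e)
    · simp [Nat.factorization_eq_zero_of_not_prime _ hℓ]
  · intro h
    exact nonempty_addEquiv_of_factorization _ _ (hm h1) (hm h2)
      (fun n _ ↦ exists_factorization_eq_of_ordCompl_eq hp h1 n.2 h)
      (fun n _ ↦ exists_factorization_eq_of_ordCompl_eq hp h2 n.2 h.symm)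
end

section
/- Let p be a prime and k ≥ 1 an integer. Let A be an abelian group fitting in an exact sequence 0 → ℤ_p → A → ℤ/p^kℤ → 0 of abelian groups (where ℤ_p is the additive group of p-adic integers), and suppose this exact sequence is totally non-split. Then A is isomorphic to ℤ_p as an abstract group. -/
/-- An element `b` of prime order `p` with `ψ b ≠ 0` yields a section of `ψ` over the
nontrivial subgroup generated by `ψ b`. -/
theorem exists_section_of_prime_nsmul_eq_zero {A C : Type*} [AddCommGroup A] [AddCommGroup C]
    {p : ℕ} (hp : p.Prime) (ψ : A →+ C) {b : A} (hb : p • b = 0) (hψb : ψ b ≠ 0) :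
    ∃ S : AddSubgroup C, S ≠ ⊥ ∧ ∃ s : S →+ A, ∀ x : S, ψ (s x) = (x : C) := by
  have hinj : Function.Injective (ψ.comp (AddSubgroup.zmultiples b).subtype) := by
    rw [injective_iff_map_eq_zero]
    rintro ⟨_, m, rfl⟩ hm
    have hm' : m • ψ b = 0 := by simpa using hm
    have hord : addOrderOf (ψ b) = p :=
      have := Fact.mk hp
      addOrderOf_eq_prime (by rw [← map_nsmul, hb, map_zero]) hψb
    obtain ⟨l, rfl⟩ : (p : ℤ) ∣ m := hord ▸ addOrderOf_dvd_iff_zsmul_eq_zero.mpr hm'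
    ext
    simp [mul_comm (p : ℤ) l, mul_zsmul, hb]
  let e := AddMonoidHom.ofInjective hinj
  refine ⟨(ψ.comp (AddSubgroup.zmultiples b).subtype).range, ?_,
    (AddSubgroup.zmultiples b).subtype.comp e.symm.toAddMonoidHom, fun x => ?_⟩
  · rw [Ne, AddMonoidHom.range_eq_bot_iff]
    intro h
    exact hψb (DFunLike.congr_fun h ⟨b, AddSubgroup.mem_zmultiples b⟩)
  · exact congrArg Subtype.val (e.apply_symm_apply x)

/-- Let `p` be a prime and `k ≥ 1`. If `A` is an abelian group fitting in a totally
non-split exact sequence `0 → ℤ_p → A → ℤ/p^kℤ → 0`, then `A ≅ ℤ_p` as an abstract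
group. Totally non-split means: for every nontrivial subgroup `S` of `ℤ/p^kℤ` there
is no homomorphism `s : S → A` with `ψ ∘ s = id_S`. -/
theorem stmt11 (p : ℕ) [Fact p.Prime] (k : ℕ) (hk : 1 ≤ k)
    (A : Type) [AddCommGroup A]
    (ι : ℤ_[p] →+ A) (ψ : A →+ ZMod (p ^ k))
    (hι : Function.Injective ι) (hψ : Function.Surjective ψ)
    (hexact : ι.range = ψ.ker)
    (hns : ∀ S : AddSubgroup (ZMod (p ^ k)), S ≠ ⊥ →
      ¬ ∃ s : S →+ A, ∀ x : S, ψ (s x) = (x : ZMod (p ^ k))) :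
    Nonempty (A ≃+ ℤ_[p]) := by
  have hp : p.Prime := Fact.out
  have hker : ∀ c : A, ψ c = 0 → ∃ z, ι z = c := fun c hc => by
    rwa [← AddMonoidHom.mem_range, hexact]
  have hψι : ∀ z, ψ (ι z) = 0 := fun z => by
    rw [← AddMonoidHom.mem_ker, ← hexact]
    exact ⟨z, rfl⟩
  have hmul : ∀ c : A, ∃ z, ι z = p ^ k • c := fun c => hker _ (by
    rw [map_nsmul, nsmul_eq_mul, ZMod.natCast_self, zero_mul])
  obtain ⟨a, ha⟩ := hψ 1
  obtain ⟨x, hx⟩ := hmul a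
  have hxu : IsUnit x := by
    by_contra hxn
    obtain ⟨y, rfl⟩ : (p : ℤ_[p]) ∣ x := by
      rw [← PadicInt.norm_lt_one_iff_dvd]
      exact lt_of_le_of_ne (PadicInt.norm_le_one x) (fun h => hxn (PadicInt.isUnit_iff.mpr h))
    have hpk : p * p ^ (k - 1) = p ^ k := by rw [← pow_succ', Nat.sub_add_cancel hk]
    have hb : p • (p ^ (k - 1) • a - ι y) = 0 := by
      rw [smul_sub, ← mul_nsmul', hpk, ← hx, ← nsmul_eq_mul, map_nsmul, sub_self]
    have hψb : ψ (p ^ (k - 1) • a - ι y) ≠ 0 := by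
      rw [map_sub, hψι, sub_zero, map_nsmul, ha, nsmul_one, Ne, ZMod.natCast_eq_zero_iff,
        Nat.pow_dvd_pow_iff_le_right hp.one_lt]
      omega
    obtain ⟨S, hS, hs⟩ := exists_section_of_prime_nsmul_eq_zero hp ψ hb hψb
    exact hns S hS hs
  choose f hf using hmul
  have hdecomp : ∀ c : A, ∃ (n : ℕ) (z : ℤ_[p]), c = n • a + ι z := fun c => by
    have : NeZero (p ^ k) := ⟨pow_ne_zero _ hp.ne_zero⟩
    obtain ⟨z, hz⟩ := hker (c - (ψ c).val • a) (by simp [ha])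
    exact ⟨(ψ c).val, z, by rw [hz]; abel⟩
  have hval : ∀ (n : ℕ) (z : ℤ_[p]), f (n • a + ι z) = n * x + p ^ k * z := fun n z => hι (by
    rw [hf, smul_add, smul_comm, ← hx, ← map_nsmul, ← map_nsmul, ← map_add]
    simp)
  let F : A →+ ℤ_[p] := AddMonoidHom.mk' f fun c d => hι (by
    rw [map_add, hf, hf, hf, smul_add])
  refine ⟨AddEquiv.ofBijective F ⟨?_, fun w => ?_⟩⟩
  · rw [injective_iff_map_eq_zero]
    intro c hc
    have hc' : f c = 0 := hc
    have hψc : ψ c = 0 := by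
      obtain ⟨n, z, rfl⟩ := hdecomp c
      rw [hval] at hc'
      have hdvd : (p : ℤ_[p]) ^ k ∣ ((n : ℤ) : ℤ_[p]) := by
        rw [Int.cast_natCast, ← hxu.dvd_mul_right, eq_neg_of_add_eq_zero_left hc']
        exact (dvd_mul_right _ _).neg_right
      rw [PadicInt.pow_p_dvd_int_iff] at hdvd
      rw [map_add, hψι, add_zero, map_nsmul, ha, nsmul_one, ZMod.natCast_eq_zero_iff]
      exact_mod_cast hdvd
    obtain ⟨z, rfl⟩ := hker c hψc
    have hz := hval 0 z
    rw [zero_smul, zero_add, hc', Nat.cast_zero, zero_mul, zero_add] at hz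
    have hz0 : z = 0 := by
      simpa [hp.ne_zero] using hz.symm
    rw [hz0, map_zero]
  · obtain ⟨v, rfl⟩ := hxu.dvd (a := w)
    obtain ⟨z, hz⟩ := Ideal.mem_span_singleton.mp (PadicInt.appr_spec k v)
    refine ⟨v.appr k • a + ι (z * x), (hval _ _).trans ?_⟩
    linear_combination -x * hz
end

section
/- Let l be a prime, let A be a finite abelian l-group, and let (k_i)_{i∈ℕ} be a sequence of powers of l with k_i ≥ l for all i and with (k_i) unbounded. Then there exists an abelian group B in which every element has order a power of l, together with an injective group homomorphism ι : A → B, such that: (i) the quotient B/ι(A) is isomorphic to the direct sum ⊕_{i∈ℕ} ℤ/k_iℤ; and (ii) ι(A) = ⋂_{n≥1} nB, the intersection over all positive integers n of the subgroups nB = {n·b : b ∈ B}. -/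
open scoped DirectSum

/-- Given nonzero `k i` and elements `a i` of an abelian group `A`, there is an extension of
`⨁ i, ZMod (k i)` by `A` in which each `a i` becomes divisible by `k i`. -/
theorem exists_extension_directSum_zmod {I A : Type} [AddCommGroup A] (k : I → ℕ)
    (hk : ∀ i, k i ≠ 0) (a : I → A) :
    ∃ (B : Type) (_ : AddCommGroup B) (ι : A →+ B) (π : B →+ ⨁ i, ZMod (k i)),
      Function.Injective ι ∧ Function.Surjective π ∧ π.ker = ι.range ∧
      ∀ i, ∃ b : B, k i • b = ι (a i) := by
  classical
  let s : (⨁ _ : I, ℤ) →+ A := DirectSum.toAddMonoid fun i => zmultiplesHom A (a i)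
  let m : (⨁ _ : I, ℤ) →+ ⨁ _ : I, ℤ := DirectSum.map fun i => AddMonoidHom.mulLeft (k i : ℤ)
  let q : (⨁ _ : I, ℤ) →+ ⨁ i, ZMod (k i) :=
    DirectSum.map fun i => Int.castAddHom (ZMod (k i))
  let ρ : (⨁ _ : I, ℤ) →+ A × (⨁ _ : I, ℤ) := (-s).prod m
  have m_apply (c : ⨁ _ : I, ℤ) (i : I) : m c i = k i * c i := DirectSum.map_apply _ _ _
  have q_apply (c : ⨁ _ : I, ℤ) (i : I) : q c i = (c i : ZMod (k i)) :=
    DirectSum.map_apply _ _ _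
  have m_inj : ∀ c, m c = 0 → c = 0 := fun c hc => by
    ext i
    have := m_apply c i
    rw [hc] at this
    simpa [hk i] using this.symm
  have q_m (c) : q (m c) = 0 := by
    ext i
    rw [q_apply, m_apply]
    simp
  have ker_q (c) (hc : q c = 0) : ∃ d, m d = c := by
    refine ⟨DFinsupp.mapRange (fun i (z : ℤ) => z / k i) (by simp) c, ?_⟩
    ext i
    rw [m_apply]
    refine (congrArg _ (DFinsupp.mapRange_apply _ _ _ _)).trans (Int.mul_ediv_cancel' ?_)
    have := q_apply c i
    rw [hc] at this
    exact (ZMod.intCast_zmod_eq_zero_iff_dvd _ _).1 this.symm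
  let mk := QuotientAddGroup.mk' ρ.range
  let π := QuotientAddGroup.lift ρ.range (q.comp (AddMonoidHom.snd A _)) (by
    rintro _ ⟨c, rfl⟩
    exact q_m c)
  refine ⟨_, inferInstance, mk.comp (AddMonoidHom.inl A _), π, ?_, ?_, ?_, ?_⟩
  · rw [injective_iff_map_eq_zero]
    intro x hx
    obtain ⟨c, hc⟩ := (QuotientAddGroup.eq_zero_iff _).1 hx
    have hc0 : c = 0 := m_inj c (congrArg Prod.snd hc)
    rw [hc0, map_zero] at hc
    exact (congrArg Prod.fst hc).symm
  · intro y
    obtain ⟨c, rfl⟩ : ∃ c, q c = y :=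
      (DirectSum.map_surjective _).2 (fun i => ZMod.intCast_surjective) y
    exact ⟨mk (0, c), rfl⟩
  · ext b
    obtain ⟨⟨x, c⟩, rfl⟩ := QuotientAddGroup.mk'_surjective _ b
    constructor
    · intro h
      obtain ⟨d, rfl⟩ := ker_q c h
      refine ⟨x + s d, (QuotientAddGroup.eq_iff_sub_mem).2 ⟨-d, ?_⟩⟩
      simp [ρ]
    · rintro ⟨y, hy⟩
      rw [← hy]
      exact map_zero q
  · intro i
    refine ⟨mk (0, DirectSum.of _ i 1), ?_⟩
    rw [← map_nsmul]
    refine (QuotientAddGroup.eq_iff_sub_mem).2 ⟨DirectSum.of _ i 1, ?_⟩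
    simp [ρ, s, m, ← map_nsmul]

/-- If `k` is unbounded and `A` is countable, some sequence in `A` takes each value at indices
where `k` is arbitrarily large. -/
theorem exists_seq_forall_exists_eq_and_le {A : Type*} [Countable A] [Nonempty A] (k : ℕ → ℕ)
    (hunb : ∀ M, ∃ i, M ≤ k i) : ∃ a : ℕ → A, ∀ x M, ∃ i, a i = x ∧ M ≤ k i := by
  obtain ⟨f, hf⟩ := exists_surjective_nat (A × ℕ)
  have hfreq (M : ℕ) : ∃ᶠ i in Filter.atTop, M ≤ k i := by
    rw [Filter.frequently_atTop]
    intro N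
    by_contra! h
    obtain ⟨i, hi⟩ := hunb (M + ∑ j ∈ Finset.range N, k j + 1)
    rcases lt_or_ge i N with hiN | hiN
    · have := Finset.single_le_sum (f := k) (fun _ _ => Nat.zero_le _) (Finset.mem_range.2 hiN)
      omega
    · have := h i hiN
      omega
  obtain ⟨φ, hφ, hle⟩ := Filter.extraction_forall_of_frequently fun n => hfreq (f n).2
  refine ⟨Function.extend φ (fun n => (f n).1) fun _ => Classical.arbitrary A, fun x M => ?_⟩
  obtain ⟨n, hn⟩ := hf (x, M)
  refine ⟨φ n, ?_, ?_⟩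
  · rw [hφ.injective.extend_apply, hn]
  · simpa [hn] using hle n

theorem exists_pow_nsmul_eq_zero_directSum_zmod {I : Type*} {l : ℕ} {k : I → ℕ}
    (hk : ∀ i, ∃ m, k i = l ^ m) (y : ⨁ i, ZMod (k i)) : ∃ n : ℕ, l ^ n • y = 0 := by
  classical
  induction y using DirectSum.induction_on with
  | zero => exact ⟨0, smul_zero _⟩
  | of i z =>
    obtain ⟨m, hm⟩ := hk i
    refine ⟨m, ?_⟩
    rw [← map_nsmul, ← hm, nsmul_eq_mul, ZMod.natCast_self, zero_mul, map_zero]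
  | add y z hy hz =>
    obtain ⟨m, hm⟩ := hy
    obtain ⟨n, hn⟩ := hz
    refine ⟨m + n, ?_⟩
    rw [smul_add, pow_add, mul_nsmul, hm, mul_nsmul', hn, smul_zero, smul_zero, add_zero]

theorem exists_nsmul_eq_of_coprime {B : Type*} [AddCommGroup B] {b : B} {N m : ℕ}
    (hb : N • b = 0) (h : N.Coprime m) : ∃ c : B, m • c = b := by
  refine ⟨Nat.gcdB N m • b, ?_⟩
  have hbez := Nat.gcd_eq_gcd_ab N m
  rw [h.gcd_eq_one] at hbez
  have h1 : ((1 : ℕ) : ℤ) • b = (N * Nat.gcdA N m + m * Nat.gcdB N m : ℤ) • b := by rw [hbez]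
  rw [add_smul, mul_comm (N : ℤ), mul_smul, mul_smul, natCast_zsmul, natCast_zsmul,
    natCast_zsmul, hb, smul_zero, zero_add, one_smul] at h1
  exact h1.symm

/-- Existence part: given a prime `l`, a finite abelian `l`-group `A`, and an unbounded
sequence `(k_i)` of powers of `l` with `k_i ≥ l`, there is an abelian group `B` in which
every element has order a power of `l` and an injection `ι : A → B` with
`B/ι(A) ≅ ⊕_{i ∈ ℕ} ℤ/k_iℤ` and `ι(A) = ⋂_{n ≥ 1} nB`. -/
theorem stmt13 (l : ℕ) (hl : l.Prime) (A : Type) [AddCommGroup A] [Finite A]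
    (hA : ∃ n : ℕ, Nat.card A = l ^ n)
    (k : ℕ → ℕ) (hkpow : ∀ i, ∃ m : ℕ, k i = l ^ m) (hkl : ∀ i, l ≤ k i)
    (hunb : ∀ M : ℕ, ∃ i, M ≤ k i) :
    ∃ (B : Type) (_ : AddCommGroup B) (ι : A →+ B),
      Function.Injective ι ∧
      (∀ b : B, ∃ n : ℕ, l ^ n • b = 0) ∧
      Nonempty ((B ⧸ ι.range) ≃+ (⨁ i : ℕ, ZMod (k i))) ∧
      (ι.range : Set B) = ⋂ (n : ℕ) (_ : 0 < n), Set.range (fun b : B => n • b) := by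
  have hk0 (i : ℕ) : k i ≠ 0 := (hl.pos.trans_le (hkl i)).ne'
  obtain ⟨a, ha⟩ := exists_seq_forall_exists_eq_and_le (A := A) k hunb
  obtain ⟨B, _, ι, π, hι, hπ, hker, hdiv⟩ := exists_extension_directSum_zmod k hk0 a
  have htors (b : B) : ∃ n : ℕ, l ^ n • b = 0 := by
    obtain ⟨n, hn⟩ := exists_pow_nsmul_eq_zero_directSum_zmod hkpow (π b)
    obtain ⟨m, hm⟩ := hA
    have hmem : l ^ n • b ∈ π.ker := by rw [AddMonoidHom.mem_ker, map_nsmul, hn]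
    rw [hker] at hmem
    obtain ⟨x, hx⟩ := hmem
    refine ⟨n + m, ?_⟩
    rw [pow_add, mul_nsmul, ← hx, ← map_nsmul, ← hm, card_nsmul_eq_zero', map_zero]
  refine ⟨B, _, ι, hι, htors, ?_, ?_⟩
  · rw [← hker]
    exact ⟨QuotientAddGroup.quotientKerEquivOfSurjective π hπ⟩
  · ext b
    simp only [Set.mem_iInter, Set.mem_range, SetLike.mem_coe]
    constructor
    · rintro ⟨x, rfl⟩ n hn
      obtain ⟨e, m, hm, rfl⟩ := Nat.exists_eq_pow_mul_and_not_dvd hn.ne' l hl.ne_one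
      obtain ⟨i, rfl, hi⟩ := ha x (l ^ e)
      obtain ⟨c, hc⟩ := hdiv i
      obtain ⟨r, hr⟩ := hkpow i
      rw [hr] at hi hc
      obtain ⟨d, rfl⟩ := Nat.exists_eq_add_of_le ((Nat.pow_le_pow_iff_right hl.one_lt).1 hi)
      obtain ⟨t, ht⟩ := htors (l ^ d • c)
      obtain ⟨c', hc'⟩ := exists_nsmul_eq_of_coprime ht
        (((Nat.Prime.coprime_iff_not_dvd hl).2 hm).pow_left t)
      exact ⟨c', by rw [mul_nsmul', hc', ← mul_nsmul', ← pow_add, hc]⟩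
    · intro h
      rw [← hker, AddMonoidHom.mem_ker]
      ext i
      obtain ⟨c, rfl⟩ := h (k i) (hk0 i).bot_lt
      rw [map_nsmul, DirectSum.smul_apply, nsmul_eq_mul, ZMod.natCast_self, zero_mul,
        DirectSum.zero_apply]
end

section
/- Let l be a prime, let A be a finite abelian l-group, and let (k_i)_{i∈ℕ} be a sequence of powers of l with k_i ≥ l for all i and with (k_i) unbounded. Let B and B' be abelian groups in which every element has order a power of l, and suppose there are injective homomorphisms ι : A → B and ι' : A → B' such that ι(A) = ⋂_{n≥1} nB, ι'(A) = ⋂_{n≥1} nB', and both B/ι(A) and B'/ι'(A) are isomorphic to ⊕_{i∈ℕ} ℤ/k_iℤ. Then B and B' are isomorphic as groups. -/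
open scoped DirectSum

open Finsupp in
/-- Multiplication of the `i`-th coordinate of `ℤ^(σ)` by `l ^ v i`. -/
noncomputable def powScale {σ : Type*} (l : ℕ) (v : σ → ℕ) : (σ →₀ ℤ) →ₗ[ℤ] (σ →₀ ℤ) :=
  linearCombination ℤ fun i => single i ((l : ℤ) ^ v i)

/-- `B` is generated by a copy of `A` and elements `x i`, with defining relations
`l ^ v i • x i = a i`. -/
def IsPresentedBy {σ : Type*} (l : ℕ) (v : σ → ℕ) {A : Type*} [AddCommGroup A] (a : σ → A)
    (B : Type*) [AddCommGroup B] : Prop :=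
  ∃ φ : A × (σ →₀ ℤ) →+ B, Function.Surjective φ ∧
    ∀ α c, φ (α, c) = 0 ↔
      ∃ d, c = powScale l v d ∧ α + Finsupp.linearCombination ℤ a d = 0

/-- The elements `a i` with `i ∈ I` generate `A`, even after discarding the indices where
`v` is small. -/
def TailGenerates {σ : Type*} (v : σ → ℕ) {A : Type*} [AddCommGroup A] (a : σ → A)
    (I : Set σ) : Prop :=
  ∀ (n : ℕ) (α : A), ∃ d : σ →₀ ℤ,
    (∀ j, d j ≠ 0 → j ∈ I ∧ n ≤ v j) ∧ Finsupp.linearCombination ℤ a d = α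

section

variable {σ : Type*} {l : ℕ} {v : σ → ℕ} {A : Type*} [AddCommGroup A]

theorem powScale_single (i : σ) (c : ℤ) :
    powScale l v (Finsupp.single i c) = Finsupp.single i (c * (l : ℤ) ^ v i) := by
  rw [powScale, Finsupp.linearCombination_single, Finsupp.smul_single, smul_eq_mul]

theorem powScale_apply (d : σ →₀ ℤ) (i : σ) : powScale l v d i = (l : ℤ) ^ v i * d i := by
  classical
  induction d using Finsupp.induction_linear with
  | zero => simp
  | add f g hf hg => simp [hf, hg, mul_add]
  | single j c =>
    by_cases h : j = i
    · subst h; simp [powScale, mul_comm]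
    · simp [powScale, h]

theorem linearCombination_eq_zero_of_forall {M : Type*} [AddCommGroup M] (f : σ → M)
    (d : σ →₀ ℤ) (h : ∀ i, d i ≠ 0 → d i • f i = 0) :
    Finsupp.linearCombination ℤ f d = 0 := by
  rw [Finsupp.linearCombination_apply]
  exact Finset.sum_eq_zero fun i hi => h i (Finsupp.mem_support_iff.mp hi)

theorem linearCombination_linearCombination_eq_zero (I : Set σ) (f : σ → σ →₀ ℤ)
    (hf : ∀ i j, f i j ≠ 0 → j ∈ I) (hI : ∀ i ∈ I, f i = 0) (d : σ →₀ ℤ) :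
    Finsupp.linearCombination ℤ f (Finsupp.linearCombination ℤ f d) = 0 := by
  induction d using Finsupp.induction_linear with
  | zero => simp
  | add x y hx hy => simp [hx, hy]
  | single i c =>
    rw [Finsupp.linearCombination_single, map_smul,
      linearCombination_eq_zero_of_forall f (f i) fun j hj => by rw [hI j (hf i j hj), smul_zero],
      smul_zero]

/-- Relations `l ^ v i • x i = a i` with `i ∉ I` can be changed arbitrarily, as long as the
relations with `i ∈ I` are kept and tail-generate `A`. -/
theorem IsPresentedBy.change {B : Type*} [AddCommGroup B] {a b : σ → A} {I : Set σ}
    (hB : IsPresentedBy l v a B) (hab : ∀ i ∈ I, a i = b i) (ha : TailGenerates v a I) :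
    IsPresentedBy l v b B := by
  classical
  obtain ⟨φ, hφ, hker⟩ := hB
  have hd : ∀ i, ∃ d : σ →₀ ℤ, (∀ j, d j ≠ 0 → j ∈ I ∧ v i ≤ v j) ∧
      Finsupp.linearCombination ℤ a d = b i - a i ∧ (i ∈ I → d = 0) := by
    intro i
    by_cases hi : i ∈ I
    · exact ⟨0, by simp, by simp [hab i hi], fun _ => rfl⟩
    · obtain ⟨d, hd, hda⟩ := ha (v i) (b i - a i)
      exact ⟨d, hd, hda, fun h => absurd h hi⟩
  choose f hfI hfa hf0 using hd
  let g : σ → σ →₀ ℤ := fun i =>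
    Finsupp.onFinset (f i).support (fun j => f i j * (l : ℤ) ^ (v j - v i)) fun j hj => by
      rw [Finsupp.mem_support_iff]; exact left_ne_zero_of_mul hj
  have hg : ∀ i j, g i j = f i j * (l : ℤ) ^ (v j - v i) := fun i j => rfl
  let D := Finsupp.linearCombination ℤ f
  let M := Finsupp.linearCombination ℤ g
  have hD : ∀ d, D (D d) = 0 :=
    linearCombination_linearCombination_eq_zero I f (fun i j h => (hfI i j h).1) hf0
  have hM : ∀ d, M (M d) = 0 := by
    refine linearCombination_linearCombination_eq_zero I g (fun i j h => ?_) fun i hi => ?_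
    · rw [hg] at h
      exact (hfI i j (left_ne_zero_of_mul h)).1
    · ext j
      simp [hg, hf0 i hi]
  have hMD : ∀ d, M (powScale l v d) = powScale l v (D d) := by
    intro d
    induction d using Finsupp.induction_linear with
    | zero => simp
    | add x y hx hy => simp [hx, hy]
    | single i c =>
      ext j
      rw [powScale_apply, powScale_single]
      simp only [M, D, Finsupp.linearCombination_single, Finsupp.smul_apply, smul_eq_mul, hg]
      by_cases h : f i j = 0
      · simp [h]
      · have hij : (l : ℤ) ^ v j = l ^ v i * l ^ (v j - v i) := by
          rw [← pow_add, Nat.add_sub_cancel' (hfI i j h).2]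
        rw [hij]
        ring
  have hba : ∀ d, Finsupp.linearCombination ℤ b d =
      Finsupp.linearCombination ℤ a (d + D d) := by
    intro d
    induction d using Finsupp.induction_linear with
    | zero => simp
    | add x y hx hy => rw [map_add, hx, hy, ← map_add, map_add D]; congr 1; abel
    | single i c => simp [D, hfa, smul_sub]
  let θ : A × (σ →₀ ℤ) →+ A × (σ →₀ ℤ) :=
    AddMonoidHom.prodMap (AddMonoidHom.id A) (LinearMap.id + M).toAddMonoidHom
  have hθ : ∀ α c, θ (α, c) = (α, c + M c) := fun α c => rfl
  refine ⟨φ.comp θ, fun y => ?_, fun α c => ?_⟩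
  · obtain ⟨⟨α, c⟩, rfl⟩ := hφ y
    refine ⟨(α, c - M c), ?_⟩
    simp [hθ, hM]
  · rw [AddMonoidHom.comp_apply, hθ, hker]
    constructor
    · rintro ⟨d, hc, hα⟩
      refine ⟨d - D d, ?_, ?_⟩
      · rw [map_sub, ← hMD, ← hc, map_add, hM]
        abel
      · rw [hba, map_sub, hD]
        simpa using hα
    · rintro ⟨d, rfl, hα⟩
      exact ⟨d + D d, by rw [map_add, hMD], by rw [← hba]; exact hα⟩

theorem IsPresentedBy.nonempty_addEquiv {a : σ → A} {B B' : Type*} [AddCommGroup B]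
    [AddCommGroup B'] (hB : IsPresentedBy l v a B) (hB' : IsPresentedBy l v a B') :
    Nonempty (B ≃+ B') := by
  obtain ⟨φ, hφ, hker⟩ := hB
  obtain ⟨ψ, hψ, hker'⟩ := hB'
  have h : φ.ker = ψ.ker := by
    ext ⟨α, c⟩
    rw [AddMonoidHom.mem_ker, AddMonoidHom.mem_ker, hker, hker']
  exact ⟨(QuotientAddGroup.quotientKerEquivOfSurjective φ hφ).symm.trans
    ((QuotientAddGroup.quotientAddEquivOfEq h).trans
      (QuotientAddGroup.quotientKerEquivOfSurjective ψ hψ))⟩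

theorem TailGenerates.exists_bound [Finite A] {a : σ → A} (ha : TailGenerates v a Set.univ)
    (n : ℕ) : ∃ N, ∀ α : A, ∃ d : σ →₀ ℤ, (∀ j, d j ≠ 0 → n ≤ v j ∧ v j < N) ∧
      Finsupp.linearCombination ℤ a d = α := by
  classical
  have := Fintype.ofFinite A
  choose d hd hda using ha n
  refine ⟨(Finset.univ.sup fun α => (d α).support.sup v) + 1, fun α => ⟨d α, fun j hj => ?_, hda α⟩⟩
  refine ⟨(hd α j hj).2, Nat.lt_succ_of_le ?_⟩
  exact (Finset.le_sup (f := v) (Finsupp.mem_support_iff.mpr hj)).trans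
    (Finset.le_sup (f := fun α => (d α).support.sup v) (Finset.mem_univ α))

theorem TailGenerates.exists_split [Finite A] {a b : σ → A}
    (ha : TailGenerates v a Set.univ) (hb : TailGenerates v b Set.univ) :
    ∃ I : Set σ, TailGenerates v a I ∧ TailGenerates v b Iᶜ := by
  choose p hp using ha.exists_bound
  choose q hq using hb.exists_bound
  let g : ℕ → ℕ := fun n => max (n + 1) (max (p n) (q n))
  let t : ℕ → ℕ := fun n => g^[n] 0
  have hsucc : ∀ n, t (n + 1) = g (t n) := fun n => Function.iterate_succ_apply' g n 0
  have hmono : StrictMono t := strictMono_nat_of_lt_succ fun n => by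
    rw [hsucc]
    exact lt_of_lt_of_le (Nat.lt_succ_self _) (le_max_left _ _)
  have hpt : ∀ n, p (t n) ≤ t (n + 1) := fun n => by
    rw [hsucc]
    exact (le_max_left _ _).trans (le_max_right _ _)
  have hqt : ∀ n, q (t n) ≤ t (n + 1) := fun n => by
    rw [hsucc]
    exact (le_max_right _ _).trans (le_max_right _ _)
  refine ⟨{i | ∃ n, t (2 * n) ≤ v i ∧ v i < t (2 * n + 1)}, fun n α => ?_, fun n α => ?_⟩
  · obtain ⟨d, hd, hdα⟩ := hp (t (2 * n)) α
    refine ⟨d, fun j hj => ⟨⟨n, (hd j hj).1, (hd j hj).2.trans_le (hpt _)⟩, ?_⟩, hdα⟩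
    have := hmono.id_le (2 * n)
    have := (hd j hj).1
    simp only [id] at *
    omega
  · obtain ⟨d, hd, hdα⟩ := hq (t (2 * n + 1)) α
    refine ⟨d, fun j hj => ⟨?_, ?_⟩, hdα⟩
    · rintro ⟨m, hm₁, hm₂⟩
      have h₁ := hmono.lt_iff_lt.mp ((hd j hj).1.trans_lt hm₂)
      have h₂ := hmono.lt_iff_lt.mp (hm₁.trans_lt ((hd j hj).2.trans_le (hqt _)))
      omega
    · have := hmono.id_le (2 * n + 1)
      have := (hd j hj).1
      simp only [id] at *
      omega

theorem IsPresentedBy.of_tailGenerates [Finite A] {a b : σ → A} {B : Type*} [AddCommGroup B]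
    (hB : IsPresentedBy l v a B) (ha : TailGenerates v a Set.univ)
    (hb : TailGenerates v b Set.univ) : IsPresentedBy l v b B := by
  classical
  obtain ⟨I, haI, hbI⟩ := ha.exists_split hb
  have hc := hB.change (b := I.piecewise a b) (fun i hi => (Set.piecewise_eq_of_mem I a b hi).symm) haI
  refine hc.change (I := Iᶜ) (fun i hi => Set.piecewise_eq_of_notMem _ _ _ hi) fun n α => ?_
  obtain ⟨d, hd, hdα⟩ := hbI n α
  refine ⟨d, hd, ?_⟩
  rw [← hdα, ← sub_eq_zero, Finsupp.linearCombination_apply, Finsupp.linearCombination_apply,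
    Finsupp.sum, Finsupp.sum, ← Finset.sum_sub_distrib]
  refine Finset.sum_eq_zero fun i hi => ?_
  rw [Set.piecewise_eq_of_notMem _ _ _ (hd i (Finsupp.mem_support_iff.mp hi)).1, sub_self]

theorem exists_isPresentedBy [DecidableEq σ] (hl : l.Prime) {e : ℕ} (hA : ∀ α : A, l ^ e • α = 0)
    {B : Type*} [AddCommGroup B] (f : A →+ B) (hf : Function.Injective f)
    (hdiv : ∀ (n : ℕ) (α : A), ∃ b : B, l ^ n • b = f α)
    (E : (B ⧸ f.range) ≃+ (⨁ i : σ, ZMod (l ^ v i))) :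
    ∃ a : σ → A, IsPresentedBy l v a B ∧ TailGenerates v a Set.univ := by
  let q : (σ →₀ ℤ) →ₗ[ℤ] (⨁ i : σ, ZMod (l ^ v i)) :=
    Finsupp.linearCombination ℤ fun i => DirectSum.of (fun i => ZMod (l ^ v i)) i 1
  have hq_single : ∀ i c, q (Finsupp.single i c) = DirectSum.of (fun i => ZMod (l ^ v i)) i c :=
    fun i c => by
      simp only [q, Finsupp.linearCombination_single]
      rw [← map_zsmul, zsmul_one]
  have hq : ∀ c i, q c i = (c i : ZMod (l ^ v i)) := by
    intro c i
    induction c using Finsupp.induction_linear with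
    | zero => simp
    | add x y hx hy => simp [hx, hy]
    | single j c =>
      rw [hq_single]
      by_cases h : j = i
      · subst h; simp
      · simp [h, DirectSum.of_eq_of_ne _ _ _ (Ne.symm h)]
  have hqs : Function.Surjective q := by
    intro y
    induction y using DirectSum.induction_on with
    | zero => exact ⟨0, map_zero q⟩
    | of i z =>
      obtain ⟨n, rfl⟩ := ZMod.intCast_surjective z
      exact ⟨Finsupp.single i n, hq_single i n⟩
    | add x y hx hy =>
      obtain ⟨c, rfl⟩ := hx
      obtain ⟨d, rfl⟩ := hy
      exact ⟨c + d, map_add q c d⟩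
  have hx : ∀ i, ∃ x : B, (x : B ⧸ f.range) = E.symm (DirectSum.of _ i 1) := fun i =>
    QuotientAddGroup.mk_surjective _
  choose x hx using hx
  have hxq : ∀ c, ((Finsupp.linearCombination ℤ x c : B) : B ⧸ f.range) = E.symm (q c) := by
    intro c
    induction c using Finsupp.induction_linear with
    | zero => simp
    | add x y hx hy => simp [hx, hy]
    | single j c => simp [q, hx]
  have ha : ∀ i, ∃ α, f α = ((l : ℤ) ^ v i) • x i := by
    intro i
    have : ((((l : ℤ) ^ v i) • x i : B) : B ⧸ f.range) = 0 := by
      have h := hxq (Finsupp.single i ((l : ℤ) ^ v i))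
      rw [Finsupp.linearCombination_single] at h
      rw [h, map_eq_zero_iff _ E.symm.injective]
      ext j
      rw [hq, DirectSum.zero_apply, ZMod.intCast_zmod_eq_zero_iff_dvd]
      by_cases hij : i = j
      · subst hij; simp
      · simp [hij]
    exact (QuotientAddGroup.eq_zero_iff _).mp this
  choose a ha using ha
  have hxa : ∀ d, Finsupp.linearCombination ℤ x (powScale l v d) =
      f (Finsupp.linearCombination ℤ a d) := by
    intro d
    induction d using Finsupp.induction_linear with
    | zero => simp
    | add x y hx hy => simp [hx, hy]
    | single j c => rw [powScale_single, Finsupp.linearCombination_single,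
        Finsupp.linearCombination_single, map_zsmul, ha, mul_smul]
  let φ : A × (σ →₀ ℤ) →+ B := f.coprod (Finsupp.linearCombination ℤ x).toAddMonoidHom
  have hφ : ∀ α c, φ (α, c) = f α + Finsupp.linearCombination ℤ x c := fun _ _ => rfl
  have hsurj : Function.Surjective φ := by
    intro b
    obtain ⟨c, hc⟩ := hqs (E b)
    have hb : ((Finsupp.linearCombination ℤ x c : B) : B ⧸ f.range) = b := by
      rw [hxq, hc, AddEquiv.symm_apply_apply]
    obtain ⟨α, hα⟩ := QuotientAddGroup.eq.mp hb
    exact ⟨(α, c), by rw [hφ, hα]; abel⟩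
  have hker : ∀ α c, φ (α, c) = 0 ↔
      ∃ d, c = powScale l v d ∧ α + Finsupp.linearCombination ℤ a d = 0 := by
    intro α c
    constructor
    · intro h
      have hc : q c = 0 := by
        rw [← map_eq_zero_iff _ E.symm.injective, ← hxq, QuotientAddGroup.eq_zero_iff]
        exact ⟨-α, by rw [map_neg]; exact neg_eq_of_add_eq_zero_right h⟩
      have hdvd : ∀ i, (l : ℤ) ^ v i ∣ c i := fun i => by
        have := hq c i
        rw [hc, DirectSum.zero_apply, eq_comm, ZMod.intCast_zmod_eq_zero_iff_dvd] at this
        exact_mod_cast this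
      let d : σ →₀ ℤ := Finsupp.onFinset c.support (fun i => c i / (l : ℤ) ^ v i) fun i hi => by
        rw [Finsupp.mem_support_iff]
        intro h
        simp [h] at hi
      have hcd : c = powScale l v d := by
        ext i
        rw [powScale_apply]
        exact (Int.mul_ediv_cancel' (hdvd i)).symm
      refine ⟨d, hcd, hf ?_⟩
      rw [map_add, ← hxa, ← hcd, map_zero]
      exact h
    · rintro ⟨d, rfl, h⟩
      rw [hφ, hxa, ← map_add, h, map_zero]
  refine ⟨a, ⟨φ, hsurj, hker⟩, fun n α => ?_⟩
  obtain ⟨b, hb⟩ := hdiv (n + e) α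
  obtain ⟨⟨β, c⟩, rfl⟩ := hsurj b
  have hβ : l ^ (n + e) • β = 0 := by rw [pow_add, mul_smul, hA, smul_zero]
  have h0 : φ (-α, l ^ (n + e) • c) = 0 := by
    rw [← map_nsmul, Prod.smul_mk, hβ, hφ, map_zero, zero_add] at hb
    rw [hφ, hb, map_neg, neg_add_cancel]
  obtain ⟨d, hd, hα⟩ := (hker _ _).mp h0
  refine ⟨d.filter fun i => n ≤ v i, fun j hj => ⟨trivial, ?_⟩, ?_⟩
  · by_contra h
    exact hj (Finsupp.filter_apply_neg _ _ h)
  · rw [neg_add_eq_zero] at hα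
    rw [hα, eq_comm, ← sub_eq_zero, ← map_sub]
    refine linearCombination_eq_zero_of_forall a _ fun i hi => ?_
    by_cases h : n ≤ v i
    · simp [h] at hi
    · have hi := DFunLike.congr_fun hd i
      rw [powScale_apply, Finsupp.smul_apply, nsmul_eq_mul,
        show n + e = v i + (e + (n - v i)) by omega] at hi
      push_cast at hi
      rw [pow_add, mul_assoc] at hi
      have hdi := mul_left_cancel₀ (pow_ne_zero _ (by exact_mod_cast hl.ne_zero)) hi
      rw [Finsupp.sub_apply, Finsupp.filter_apply_neg (fun i => n ≤ v i) d h, sub_zero, ← hdi, pow_add,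
        mul_comm ((l : ℤ) ^ e), mul_right_comm, mul_smul]
      have := hA (a i)
      rw [← natCast_zsmul] at this
      push_cast at this
      rw [this, smul_zero]

end


/-- Uniqueness part: given a prime `l`, a finite abelian `l`-group `A`, and an unbounded
sequence `(k_i)` of powers of `l` with `k_i ≥ l`, any two abelian `l`-torsion groups
`B`, `B'` with injections `ι : A → B`, `ι' : A → B'` such that
`ι(A) = ⋂_{n ≥ 1} nB`, `ι'(A) = ⋂_{n ≥ 1} nB'` and
`B/ι(A) ≅ B'/ι'(A) ≅ ⊕_{i ∈ ℕ} ℤ/k_iℤ` are isomorphic. -/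
theorem stmt14 (l : ℕ) (hl : l.Prime) (A : Type) [AddCommGroup A] [Finite A]
    (hA : ∃ n : ℕ, Nat.card A = l ^ n)
    (k : ℕ → ℕ) (hkpow : ∀ i, ∃ m : ℕ, k i = l ^ m) (hkl : ∀ i, l ≤ k i)
    (hunb : ∀ M : ℕ, ∃ i, M ≤ k i)
    (B B' : Type) [AddCommGroup B] [AddCommGroup B']
    (htorB : ∀ b : B, ∃ n : ℕ, l ^ n • b = 0)
    (htorB' : ∀ b : B', ∃ n : ℕ, l ^ n • b = 0)
    (ι : A →+ B) (ι' : A →+ B')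
    (hι : Function.Injective ι) (hι' : Function.Injective ι')
    (hrange : (ι.range : Set B) = ⋂ (n : ℕ) (_ : 0 < n), Set.range (fun b : B => n • b))
    (hrange' : (ι'.range : Set B') = ⋂ (n : ℕ) (_ : 0 < n), Set.range (fun b : B' => n • b))
    (hquot : Nonempty ((B ⧸ ι.range) ≃+ (⨁ i : ℕ, ZMod (k i))))
    (hquot' : Nonempty ((B' ⧸ ι'.range) ≃+ (⨁ i : ℕ, ZMod (k i)))) :
    Nonempty (B ≃+ B') := by
  obtain ⟨e, he⟩ := hA
  have hA : ∀ α : A, l ^ e • α = 0 := fun α => he ▸ card_nsmul_eq_zero'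
  choose v hv using hkpow
  obtain rfl : k = fun i => l ^ v i := funext hv
  have hdiv : ∀ (C : Type) [AddCommGroup C] (f : A →+ C),
      (f.range : Set C) = ⋂ (n : ℕ) (_ : 0 < n), Set.range (fun b : C => n • b) →
      ∀ (n : ℕ) (α : A), ∃ b : C, l ^ n • b = f α := by
    intro C _ f h n α
    have hα : f α ∈ (f.range : Set C) := ⟨α, rfl⟩
    rw [h] at hα
    exact Set.mem_iInter₂.mp hα (l ^ n) (pow_pos hl.pos n)
  obtain ⟨a, hB, ha⟩ := exists_isPresentedBy hl hA ι hι (hdiv B ι hrange) hquot.some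
  obtain ⟨a', hB', ha'⟩ := exists_isPresentedBy hl hA ι' hι' (hdiv B' ι' hrange') hquot'.some
  exact (hB.of_tailGenerates ha ha').nonempty_addEquiv hB'
end

section
/- Let l be a prime and let (k_i)_{i∈ℕ} be a sequence of powers of l with k_i ≥ l for all i and with (k_i) unbounded. Let B be an abelian group in which every element has order a power of l, let π : B → ⊕_{i∈ℕ} ℤ/k_iℤ be a surjective homomorphism whose kernel A is finite and satisfies A = ⋂_{n≥1} nB, and for each i choose x_i ∈ B with π(x_i) equal to the standard generator of the i-th summand ℤ/k_iℤ. Then for every positive integer M that is a power of l, the set {k_i·x_i : i ∈ ℕ, k_i ≥ M} generates A. -/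
open scoped DirectSum

/-- Let `l` be a prime, `(k_i)` an unbounded sequence of powers of `l` with `k_i ≥ l`,
`B` an abelian `l`-torsion group, `π : B → ⊕_{i ∈ ℕ} ℤ/k_iℤ` a surjection with finite
kernel `A` satisfying `A = ⋂_{n ≥ 1} nB`, and `x_i ∈ B` with `π(x_i)` the standard
generator of the `i`-th summand. Then for every positive integer `M` which is a power
of `l`, the set `{k_i·x_i : k_i ≥ M}` generates `A`. -/
theorem stmt15 (l : ℕ) (hl : l.Prime)
    (k : ℕ → ℕ) (hkpow : ∀ i, ∃ m : ℕ, k i = l ^ m) (hkl : ∀ i, l ≤ k i)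
    (hunb : ∀ M : ℕ, ∃ i, M ≤ k i)
    (B : Type) [AddCommGroup B]
    (htorB : ∀ b : B, ∃ n : ℕ, l ^ n • b = 0)
    (π : B →+ (⨁ i : ℕ, ZMod (k i)))
    (hπ : Function.Surjective π)
    (hfin : Finite π.ker)
    (hker : (π.ker : Set B) = ⋂ (n : ℕ) (_ : 0 < n), Set.range (fun b : B => n • b))
    (x : ℕ → B)
    (hx : ∀ i, π (x i) = DirectSum.of (fun i => ZMod (k i)) i (1 : ZMod (k i)))
    (M : ℕ) (hM : 0 < M) (hMpow : ∃ m : ℕ, M = l ^ m) :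
    AddSubgroup.closure {b : B | ∃ i : ℕ, M ≤ k i ∧ b = k i • x i} = π.ker := by
  classical
  have hkpos : ∀ i, 0 < k i := fun i => hl.pos.trans_le (hkl i)
  have hkx : ∀ i, k i • x i ∈ π.ker := by
    intro i
    rw [AddMonoidHom.mem_ker, map_nsmul, hx, ← map_nsmul]
    simp
  have hcard : ∀ a ∈ π.ker, Nat.card π.ker • a = 0 := fun a ha => by
    have h := card_nsmul_eq_zero' (x := (⟨a, ha⟩ : π.ker))
    simpa using congrArg Subtype.val h
  apply le_antisymm
  · rw [AddSubgroup.closure_le]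
    rintro _ ⟨i, -, rfl⟩
    exact hkx i
  intro a ha
  have hn : 0 < M * Nat.card π.ker := Nat.mul_pos hM Nat.card_pos
  have ha' : a ∈ (π.ker : Set B) := ha
  rw [hker] at ha'
  simp only [Set.mem_iInter] at ha'
  obtain ⟨b, rfl⟩ := ha' _ hn
  set n := M * Nat.card π.ker with hn_def
  have hzero : n • π b = 0 := by simpa using ha
  set b₀ : B := ∑ i ∈ DFinsupp.support (π b), (π b i).val • x i with hb₀
  have hπb₀ : π b₀ = π b := by
    rw [hb₀, map_sum, ← DirectSum.sum_support_of (π b)]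
    refine Finset.sum_congr (by rw [DirectSum.sum_support_of]) fun i _ => ?_
    have : NeZero (k i) := ⟨(hkpos i).ne'⟩
    rw [DirectSum.sum_support_of, map_nsmul, hx, ← map_nsmul]
    simp
  have hnb : n • b = n • b₀ := by
    have h : b - b₀ ∈ π.ker := by simp [AddMonoidHom.mem_ker, hπb₀]
    rw [← sub_eq_zero, ← nsmul_sub, hn_def, mul_nsmul', hcard _ h, nsmul_zero]
  change n • b ∈ _
  rw [hnb, hb₀, Finset.smul_sum]
  refine AddSubgroup.sum_mem _ fun i _ => ?_
  have : NeZero (k i) := ⟨(hkpos i).ne'⟩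
  rcases le_or_gt M (k i) with h | h
  · have hdvd : k i ∣ n * (π b i).val := by
      rw [← ZMod.natCast_eq_zero_iff, Nat.cast_mul, ZMod.natCast_zmod_val, ← nsmul_eq_mul]
      exact DFunLike.congr_fun hzero i
    obtain ⟨q, hq⟩ := hdvd
    rw [← mul_nsmul', hq, mul_nsmul]
    refine AddSubgroup.nsmul_mem _ (AddSubgroup.mem_closure_of_mem ?_) q
    exact ⟨i, h, rfl⟩
  · have hdvd : k i ∣ M := by
      obtain ⟨m, hm⟩ := hkpow i
      obtain ⟨m', rfl⟩ := hMpow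
      rw [hm] at h ⊢
      exact pow_dvd_pow l ((Nat.pow_lt_pow_iff_right hl.one_lt).1 h).le
    obtain ⟨q, hq⟩ := hdvd
    have h0 : n • (π b i).val • x i = (q * (π b i).val) • Nat.card π.ker • k i • x i := by
      simp only [← mul_nsmul']
      rw [hn_def, hq]
      congr 1
      ring
    rw [h0, hcard _ (hkx i), nsmul_zero]
    exact AddSubgroup.zero_mem _
end

section
/- Let l be a prime, let A be a finite abelian l-group, and let (k_i)_{i∈ℕ} be a sequence of powers of l with k_i ≥ l for all i and with (k_i) unbounded. For a sequence a = (a_i)_{i∈ℕ} of elements of A, let B(a) denote the quotient of A ⊕ (⊕_{i∈ℕ} ℤ) by the subgroup generated by the elements (−a_i, k_i·e_i) for i ∈ ℕ, where e_i is the i-th standard basis element of ⊕_{i∈ℕ} ℤ. Suppose a = (a_i) and a' = (a'_i) are two sequences in A such that the set S = {i ∈ ℕ : a_i = a'_i} has the property that for every positive integer M the set {a_i : i ∈ S, k_i ≥ M} generates A. Then B(a) and B(a') are isomorphic as groups. -/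
/-- For an abelian group `A` and sequences `k : ℕ → ℕ`, `a : ℕ → A`, `BGroup k a` is the
quotient of `A ⊕ (⊕_{i ∈ ℕ} ℤ)` by the subgroup generated by the elements
`(-a_i, k_i·e_i)`, where `e_i` is the `i`-th standard basis element of `⊕_{i ∈ ℕ} ℤ`. -/
abbrev BGroup {A : Type} [AddCommGroup A] (k : ℕ → ℕ) (a : ℕ → A) : Type :=
  (A × (ℕ →₀ ℤ)) ⧸
    AddSubgroup.closure (Set.range fun i : ℕ => (-a i, Finsupp.single i (k i : ℤ)))

/-- The unipotent automorphism `(x, y) ↦ (x, y + T y)` attached to a square-zero `T`. -/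
def prodShear {A F : Type*} [AddCommGroup A] [AddCommGroup F] (T : F →+ F)
    (hT : ∀ y, T (T y) = 0) : A × F ≃+ A × F where
  toFun p := (p.1, p.2 + T p.2)
  invFun p := (p.1, p.2 - T p.2)
  left_inv p := by simp [hT]
  right_inv p := by simp [hT]
  map_add' p q := by
    ext
    · simp
    · simp only [Prod.snd_add, map_add]
      abel

/-- Every element of the subgroup generated by the common values `a j = a' j` with `m ∣ k j`
becomes divisible by `m` modulo both relation subgroups, with a quotient supported on the indices
where `a` and `a'` agree. -/
lemma exists_finsupp_mem_relations {A : Type} [AddCommGroup A] {k : ℕ → ℕ} {a a' : ℕ → A} {m : ℕ}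
    {x : A} (hx : x ∈ AddSubgroup.closure {x : A | ∃ j, a j = a' j ∧ m ∣ k j ∧ x = a j}) :
    ∃ d : ℕ →₀ ℤ, (∀ j, a j ≠ a' j → d j = 0) ∧
      (-x, (m : ℤ) • d) ∈ AddSubgroup.closure
        (Set.range fun i : ℕ => (-a i, Finsupp.single i (k i : ℤ))) ∧
      (-x, (m : ℤ) • d) ∈ AddSubgroup.closure
        (Set.range fun i : ℕ => (-a' i, Finsupp.single i (k i : ℤ))) := by
  induction hx using AddSubgroup.closure_induction with
  | mem x hx =>
    obtain ⟨j, hj, ⟨c, hc⟩, rfl⟩ := hx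
    have hd : (m : ℤ) • Finsupp.single j (c : ℤ) = Finsupp.single j (k j : ℤ) := by
      simp [hc]
    refine ⟨Finsupp.single j (c : ℤ), fun i hi => ?_, ?_, ?_⟩
    · have hij : j ≠ i := by
        rintro rfl
        exact hi hj
      simp [hij]
    · rw [hd]
      exact AddSubgroup.subset_closure ⟨j, rfl⟩
    · rw [hd, hj]
      exact AddSubgroup.subset_closure ⟨j, rfl⟩
  | zero => exact ⟨0, by simp, by simp [← Prod.zero_eq_mk], by simp [← Prod.zero_eq_mk]⟩
  | add x y _ _ hx hy =>
    obtain ⟨d, hd, h₁, h₂⟩ := hx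
    obtain ⟨e, he, h₃, h₄⟩ := hy
    have hde : (-(x + y), (m : ℤ) • (d + e)) = (-x, (m : ℤ) • d) + (-y, (m : ℤ) • e) := by
      rw [Prod.mk_add_mk, smul_add, neg_add]
    refine ⟨d + e, fun j hj => by simp [hd j hj, he j hj], ?_, ?_⟩
    · rw [hde]
      exact add_mem h₁ h₃
    · rw [hde]
      exact add_mem h₂ h₄
  | neg x _ hx =>
    obtain ⟨d, hd, h₁, h₂⟩ := hx
    have hnd : (-(-x), (m : ℤ) • (-d)) = -(-x, (m : ℤ) • d) := by
      rw [Prod.neg_mk, smul_neg]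
    refine ⟨-d, fun j hj => by simp [hd j hj], ?_, ?_⟩
    · rw [hnd]
      exact neg_mem h₁
    · rw [hnd]
      exact neg_mem h₂

/-- Large-overlap lemma: if `a` and `a'` are sequences in a finite abelian `l`-group `A`
such that the set `S = {i : a_i = a'_i}` has the property that for every positive `M`
the set `{a_i : i ∈ S, k_i ≥ M}` generates `A`, then `B(a) ≅ B(a')`. -/
theorem stmt16 (l : ℕ) (hl : l.Prime) (A : Type) [AddCommGroup A] [Finite A]
    (hA : ∃ n : ℕ, Nat.card A = l ^ n)
    (k : ℕ → ℕ) (hkpow : ∀ i, ∃ m : ℕ, k i = l ^ m) (hkl : ∀ i, l ≤ k i)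
    (hunb : ∀ M : ℕ, ∃ i, M ≤ k i)
    (a a' : ℕ → A)
    (hoverlap : ∀ M : ℕ, 0 < M →
      AddSubgroup.closure {x : A | ∃ i : ℕ, a i = a' i ∧ M ≤ k i ∧ x = a i} = ⊤) :
    Nonempty (BGroup k a ≃+ BGroup k a') := by
  have hdvd : ∀ i j, k i ≤ k j → k i ∣ k j := by
    intro i j hij
    obtain ⟨m, hm⟩ := hkpow i
    obtain ⟨n, hn⟩ := hkpow j
    rw [hm, hn] at hij ⊢
    exact pow_dvd_pow l ((Nat.pow_le_pow_iff_right hl.one_lt).1 hij)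
  have hex : ∀ i, ∃ d : ℕ →₀ ℤ, (a i = a' i → d = 0) ∧ (∀ j, a j ≠ a' j → d j = 0) ∧
      (-(a i - a' i), (k i : ℤ) • d) ∈ AddSubgroup.closure
        (Set.range fun i : ℕ => (-a i, Finsupp.single i (k i : ℤ))) ∧
      (-(a i - a' i), (k i : ℤ) • d) ∈ AddSubgroup.closure
        (Set.range fun i : ℕ => (-a' i, Finsupp.single i (k i : ℤ))) := by
    intro i
    by_cases hi : a i = a' i
    · exact ⟨0, fun _ => rfl, fun _ _ => rfl, by simp [hi, ← Prod.zero_eq_mk],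
        by simp [hi, ← Prod.zero_eq_mk]⟩
    · have hx : a i - a' i ∈
          AddSubgroup.closure {x : A | ∃ j, a j = a' j ∧ k i ∣ k j ∧ x = a j} := by
        refine AddSubgroup.closure_mono ?_
          ((hoverlap (k i) (hl.pos.trans_le (hkl i))).symm ▸ AddSubgroup.mem_top (a i - a' i))
        rintro x ⟨j, hj, hij, rfl⟩
        exact ⟨j, hj, hdvd i j hij, rfl⟩
      obtain ⟨d, hd⟩ := exists_finsupp_mem_relations hx
      exact ⟨d, fun h => absurd h hi, hd⟩
  choose d hd₀ hd hda hda' using hex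
  let T : (ℕ →₀ ℤ) →+ (ℕ →₀ ℤ) := (Finsupp.linearCombination ℤ d).toAddMonoidHom
  have hTsingle : ∀ i (c : ℤ), T (Finsupp.single i c) = c • d i := fun i c =>
    Finsupp.linearCombination_single ℤ c i
  have hTd : ∀ i, T (d i) = 0 := by
    intro i
    change (d i).sum (fun j c => c • d j) = 0
    refine Finset.sum_eq_zero fun j _ => ?_
    by_cases hj : a j = a' j
    · simp [hd₀ j hj]
    · simp [hd i j hj]
  have hTT : ∀ y, T (T y) = 0 := by
    intro y
    induction y using Finsupp.induction_linear with
    | zero => simp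
    | add y z hy hz => simp [hy, hz]
    | single i c => rw [hTsingle, map_zsmul, hTd, smul_zero]
  refine ⟨QuotientAddGroup.congr _ _ (prodShear T hTT) (le_antisymm ?_ ?_)⟩
  · rw [AddSubgroup.map_le_iff_le_comap, AddSubgroup.closure_le]
    rintro _ ⟨i, rfl⟩
    have h := add_mem (AddSubgroup.subset_closure (Set.mem_range_self i)) (hda' i)
    have heq : prodShear T hTT (-a i, Finsupp.single i (k i : ℤ)) =
        (-a' i, Finsupp.single i (k i : ℤ)) + (-(a i - a' i), (k i : ℤ) • d i) := by
      change (-a i, Finsupp.single i (k i : ℤ) + T (Finsupp.single i (k i : ℤ))) = _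
      rw [hTsingle, Prod.mk_add_mk]
      congr 1
      abel
    rw [← heq] at h
    exact h
  · rw [AddSubgroup.closure_le]
    rintro _ ⟨i, rfl⟩
    refine ⟨(prodShear T hTT).symm (-a' i, Finsupp.single i (k i : ℤ)), ?_,
      (prodShear T hTT).apply_symm_apply _⟩
    have h := sub_mem (AddSubgroup.subset_closure (Set.mem_range_self i)) (hda i)
    have heq : (prodShear T hTT).symm (-a' i, Finsupp.single i (k i : ℤ)) =
        (-a i, Finsupp.single i (k i : ℤ)) - (-(a i - a' i), (k i : ℤ) • d i) := by
      change (-a' i, Finsupp.single i (k i : ℤ) - T (Finsupp.single i (k i : ℤ))) = _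
      rw [hTsingle, Prod.mk_sub_mk]
      congr 1
      abel
    exact heq ▸ h
end

section
/- Let l be a prime, let A be a finite abelian l-group, let (k_i)_{i∈ℕ} be a sequence of powers of l with (k_i) unbounded, and let a = (a_i)_{i∈ℕ} and a' = (a'_i)_{i∈ℕ} be two sequences of elements of A, each of which strongly generates A relative to (k_i), i.e. for every positive integer M the set {a_i : k_i ≥ M} generates A and the set {a'_i : k_i ≥ M} generates A. Then there exists a partition ℕ = I₁ ∪ I₂ with I₁ ∩ I₂ = ∅ such that for every positive integer M the set {a_i : i ∈ I₁, k_i ≥ M} generates A and the set {a'_i : i ∈ I₂, k_i ≥ M} generates A. -/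
/-- Every infinite set can be split into two infinite pieces. -/
theorem Set.exists_infinite_inter_and_infinite_sdiff {α : Type*} (V : Set α) :
    ∃ B : Set α, V.Infinite → (V ∩ B).Infinite ∧ (V \ B).Infinite := by
  by_cases hV : V.Infinite
  · obtain ⟨B, C, rfl, hdisj, hcard⟩ := hV.exists_union_disjoint_cardinal_eq_of_infinite
    have hiff : B.Infinite ↔ C.Infinite := by
      rw [← Set.infinite_coe_iff, ← Set.infinite_coe_iff, Cardinal.infinite_iff,
        Cardinal.infinite_iff, hcard]
    have hor := Set.infinite_union.1 hV
    refine ⟨B, fun _ => ?_⟩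
    rw [Set.union_inter_cancel_left, Set.union_sdiff_left, hdisj.sdiff_eq_right]
    tauto
  · exact ⟨∅, fun h => absurd h hV⟩

/-- For a map `p` to a finite type, there is a threshold which `k` reaches only on those fibres of
`p` on which `k` takes infinitely many values. -/
theorem exists_forall_le_infinite_image_fiber {ι P : Type*} [Finite P] (k : ι → ℕ) (p : ι → P) :
    ∃ M : ℕ, 0 < M ∧ ∀ i, M ≤ k i → (k '' (p ⁻¹' {p i})).Infinite := by
  have hfin : (⋃ x ∈ {x : P | (k '' (p ⁻¹' {x})).Finite}, k '' (p ⁻¹' {x})).Finite :=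
    (Set.toFinite _).biUnion fun x hx => hx
  obtain ⟨b, hb⟩ := hfin.bddAbove
  refine ⟨b + 1, b.succ_pos, fun i hi hf => ?_⟩
  have : k i ≤ b := hb (Set.mem_biUnion (x := p i) hf ⟨i, rfl, rfl⟩)
  omega

/-- Partition lemma: if `a` and `a'` are two sequences in a finite abelian `l`-group `A`,
each strongly generating `A` relative to an unbounded sequence `(k_i)` of powers of `l`
(i.e. for every positive `M` the set `{a_i : k_i ≥ M}` generates `A`, and likewise for
`a'`), then there is a partition `ℕ = I₁ ∪ I₂`, `I₁ ∩ I₂ = ∅`, such that for every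
positive `M` the set `{a_i : i ∈ I₁, k_i ≥ M}` generates `A` and the set
`{a'_i : i ∈ I₂, k_i ≥ M}` generates `A`. -/
theorem stmt17 (l : ℕ) (hl : l.Prime) (A : Type) [AddCommGroup A] [Finite A]
    (hA : ∃ n : ℕ, Nat.card A = l ^ n)
    (k : ℕ → ℕ) (hkpow : ∀ i, ∃ m : ℕ, k i = l ^ m)
    (hunb : ∀ M : ℕ, ∃ i, M ≤ k i)
    (a a' : ℕ → A)
    (ha : ∀ M : ℕ, 0 < M →
      AddSubgroup.closure {x : A | ∃ i : ℕ, M ≤ k i ∧ x = a i} = ⊤)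
    (ha' : ∀ M : ℕ, 0 < M →
      AddSubgroup.closure {x : A | ∃ i : ℕ, M ≤ k i ∧ x = a' i} = ⊤) :
    ∃ I₁ I₂ : Set ℕ, I₁ ∪ I₂ = Set.univ ∧ I₁ ∩ I₂ = ∅ ∧
      (∀ M : ℕ, 0 < M →
        AddSubgroup.closure {x : A | ∃ i ∈ I₁, M ≤ k i ∧ x = a i} = ⊤) ∧
      (∀ M : ℕ, 0 < M →
        AddSubgroup.closure {x : A | ∃ i ∈ I₂, M ≤ k i ∧ x = a' i} = ⊤) := by
  obtain ⟨M₀, hM₀, hinf⟩ := exists_forall_le_infinite_image_fiber k fun i => (a i, a' i)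
  choose B hB using fun x : A × A =>
    Set.exists_infinite_inter_and_infinite_sdiff (k '' ((fun i => (a i, a' i)) ⁻¹' {x}))
  let I : Set ℕ := {i | k i ∈ B (a i, a' i)}
  refine ⟨I, Iᶜ, Set.union_compl_self I, Set.inter_compl_self I, fun M _ => ?_, fun M _ => ?_⟩
  · rw [eq_top_iff, ← ha M₀ hM₀]
    refine AddSubgroup.closure_mono ?_
    rintro _ ⟨i, hi, rfl⟩
    obtain ⟨_, ⟨⟨j, hj, rfl⟩, hjB⟩, hjM⟩ := (hB _ (hinf i hi)).1.exists_gt M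
    obtain ⟨h₁, h₂⟩ := Prod.mk.inj hj
    exact ⟨j, by simpa [I, h₁, h₂] using hjB, hjM.le, h₁.symm⟩
  · rw [eq_top_iff, ← ha' M₀ hM₀]
    refine AddSubgroup.closure_mono ?_
    rintro _ ⟨i, hi, rfl⟩
    obtain ⟨_, ⟨⟨j, hj, rfl⟩, hjB⟩, hjM⟩ := (hB _ (hinf i hi)).2.exists_gt M
    obtain ⟨h₁, h₂⟩ := Prod.mk.inj hj
    exact ⟨j, by simpa [I, h₁, h₂] using hjB, hjM.le, h₂.symm⟩
end
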